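/- Let V = Q^4 with basis a1, a2, b1, b2, and let G be the subgroup of GL(V) generated by the three linear maps: sigma (a1 -> b1, a2 -> b2, b1 -> a1, b2 -> a2), nu = -id, and tau (a1 -> a1 + b1, a2 -> a2 + b2, b1 -> -b1, b2 -> -b2). Then the dimension of the G-invariant subspace of the k-th exterior power of V equals 1 for k = 0, 2, 4 and equals 0 for k = 1, 3. -/

import Mathlib

/-- `σ : a1 ↦ b1, a2 ↦ b2, b1 ↦ a1, b2 ↦ a2` (basis `a1,a2,b1,b2` of ℚ⁴). -/
def sigmaM : Matrix (Fin 4) (Fin 4) ℚ := !![0,0,1,0; 0,0,0,1; 1,0,0,0; 0,1,0,0]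

/-- `τ : a1 ↦ a1 + b1, a2 ↦ a2 + b2, b1 ↦ -b1, b2 ↦ -b2`. -/
def tauM : Matrix (Fin 4) (Fin 4) ℚ := !![1,0,0,0; 0,1,0,0; 1,0,-1,0; 0,1,0,-1]

lemma sigmaM_sq : sigmaM * sigmaM = 1 := by
  ext i j
  fin_cases i <;> fin_cases j <;>
    simp [sigmaM, Matrix.mul_apply, Fin.sum_univ_four, Matrix.one_apply,
      Matrix.vecHead, Matrix.vecTail]

lemma tauM_sq : tauM * tauM = 1 := by
  ext i j
  fin_cases i <;> fin_cases j <;>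
    simp [tauM, Matrix.mul_apply, Fin.sum_univ_four, Matrix.one_apply,
      Matrix.vecHead, Matrix.vecTail]

/-- `σ` as an element of `GL(ℚ⁴)`. -/
def sigmaU : (Matrix (Fin 4) (Fin 4) ℚ)ˣ := ⟨sigmaM, sigmaM, sigmaM_sq, sigmaM_sq⟩

/-- `ν = -id` as an element of `GL(ℚ⁴)`. -/
def nuU : (Matrix (Fin 4) (Fin 4) ℚ)ˣ := -1

/-- `τ` as an element of `GL(ℚ⁴)`. -/
def tauU : (Matrix (Fin 4) (Fin 4) ℚ)ˣ := ⟨tauM, tauM, tauM_sq, tauM_sq⟩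

/-- The subgroup of `GL(ℚ⁴)` generated by `σ`, `ν = -id` and `τ`. -/
def Ggroup : Subgroup (Matrix (Fin 4) (Fin 4) ℚ)ˣ :=
  Subgroup.closure {sigmaU, nuU, tauU}

/-- The submodule of the exterior algebra of `ℚ⁴` fixed by the action of
every element of a subgroup `G` of `GL(ℚ⁴)`. -/
def fixedSubmodule (G : Subgroup (Matrix (Fin 4) (Fin 4) ℚ)ˣ) :
    Submodule ℚ (ExteriorAlgebra ℚ (Fin 4 → ℚ)) where
  carrier := {x | ∀ g ∈ G,
    ExteriorAlgebra.map (Matrix.toLin' (g : Matrix (Fin 4) (Fin 4) ℚ)) x = x}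
  add_mem' := by
    intro a b ha hb g hg
    rw [map_add, ha g hg, hb g hg]
  zero_mem' := by
    intro g hg
    rw [map_zero]
  smul_mem' := by
    intro c a ha g hg
    rw [map_smul, ha g hg]


set_option linter.unusedSimpArgs false

noncomputable section

/-- Basis vector in the exterior algebra. -/
def ee (i : Fin 4) : ExteriorAlgebra ℚ (Fin 4 → ℚ) := ExteriorAlgebra.ι ℚ (Pi.single i 1)

abbrev SS := ExteriorAlgebra.map (Matrix.toLin' sigmaM)
abbrev TT := ExteriorAlgebra.map (Matrix.toLin' tauM)
abbrev NN := ExteriorAlgebra.map (Matrix.toLin' (-1 : Matrix (Fin 4) (Fin 4) ℚ))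

lemma ee_sq (i : Fin 4) : ee i * ee i = 0 := ExteriorAlgebra.ι_sq_zero _

lemma ee_swap (i j : Fin 4) : ee i * ee j = - (ee j * ee i) :=
  eq_neg_of_add_eq_zero_left (ExteriorAlgebra.ι_add_mul_swap _ _)

lemma ee_sq' (i : Fin 4) (x) : ee i * (ee i * x) = 0 := by
  rw [← mul_assoc, ee_sq, zero_mul]

lemma ee_swap' (i j : Fin 4) (x) : ee i * (ee j * x) = - (ee j * (ee i * x)) := by
  rw [← mul_assoc, ee_swap, neg_mul, mul_assoc]

lemma fixed_iff (x) : x ∈ fixedSubmodule Ggroup ↔ SS x = x ∧ NN x = x ∧ TT x = x := by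
  constructor
  · intro h
    refine ⟨h sigmaU (Subgroup.subset_closure (by simp)), ?_,
      h tauU (Subgroup.subset_closure (by simp))⟩
    have := h nuU (Subgroup.subset_closure (by simp))
    simpa [nuU, NN] using this
  · rintro ⟨h1, h2, h3⟩ g hg
    have mulmap : ∀ (a b : Matrix (Fin 4) (Fin 4) ℚ) (y),
        ExteriorAlgebra.map (Matrix.toLin' (a * b)) y =
        ExteriorAlgebra.map (Matrix.toLin' a) (ExteriorAlgebra.map (Matrix.toLin' b) y) := by
      intro a b y
      rw [Matrix.toLin'_mul, ← ExteriorAlgebra.map_comp_map]; rfl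
    unfold Ggroup at hg
    induction hg using Subgroup.closure_induction with
    | mem g hg =>
      rcases hg with rfl | rfl | rfl
      · exact h1
      · simpa [nuU, NN] using h2
      · exact h3
    | one => simp
    | mul a b _ _ ha hb => rw [Units.val_mul, mulmap, hb, ha]
    | inv a _ ha =>
      conv_lhs => rw [← ha]
      rw [← mulmap, Units.inv_mul]; simp

lemma S0 : SS (ee 0) = ee 2 := by
  simp only [ee, ExteriorAlgebra.map_apply_ι]; congr 1; ext i; fin_cases i <;> simp [sigmaM]
lemma S1 : SS (ee 1) = ee 3 := by
  simp only [ee, ExteriorAlgebra.map_apply_ι]; congr 1; ext i; fin_cases i <;> simp [sigmaM]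
lemma S2 : SS (ee 2) = ee 0 := by
  simp only [ee, ExteriorAlgebra.map_apply_ι]; congr 1; ext i; fin_cases i <;> simp [sigmaM]
lemma S3 : SS (ee 3) = ee 1 := by
  simp only [ee, ExteriorAlgebra.map_apply_ι]; congr 1; ext i; fin_cases i <;> simp [sigmaM]
lemma T0 : TT (ee 0) = ee 0 + ee 2 := by
  simp only [ee, ExteriorAlgebra.map_apply_ι, ← map_add]
  congr 1; ext i; fin_cases i <;> simp [tauM]
lemma T1 : TT (ee 1) = ee 1 + ee 3 := by
  simp only [ee, ExteriorAlgebra.map_apply_ι, ← map_add]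
  congr 1; ext i; fin_cases i <;> simp [tauM]
lemma T2 : TT (ee 2) = - ee 2 := by
  simp only [ee, ExteriorAlgebra.map_apply_ι, ← map_neg]
  congr 1; ext i; fin_cases i <;> simp [tauM]
lemma T3 : TT (ee 3) = - ee 3 := by
  simp only [ee, ExteriorAlgebra.map_apply_ι, ← map_neg]
  congr 1; ext i; fin_cases i <;> simp [tauM]

lemma N_apply (k : ℕ) (x) (hx : x ∈ ⋀[ℚ]^k (Fin 4 → ℚ)) : NN x = (-1 : ℚ)^k • x := by
  rw [← ExteriorAlgebra.ιMulti_span_fixedDegree] at hx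
  induction hx using Submodule.span_induction with
  | mem x h =>
    obtain ⟨v, rfl⟩ := h
    rw [ExteriorAlgebra.map_apply_ιMulti]
    have := (ExteriorAlgebra.ιMulti ℚ k (M := Fin 4 → ℚ)).map_smul_univ (fun _ => (-1 : ℚ)) v
    simp only [Finset.prod_const, Finset.card_univ, Fintype.card_fin] at this
    rw [← this]
    congr 1; ext i j; simp
  | zero => simp
  | add x y _ _ hx hy => rw [map_add, hx, hy, smul_add]
  | smul c x _ hx => rw [map_smul, hx, smul_comm]

lemma span_ee (k : ℕ) : ⋀[ℚ]^k (Fin 4 → ℚ) = Submodule.span ℚ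
    (Set.range fun f : Fin k → Fin 4 => (List.ofFn fun i => ee (f i)).prod) := by
  rw [← exteriorPower.ιMulti_span_fixedDegree_of_span_eq_top ℚ k
    (s := Set.range fun i : Fin 4 => (Pi.single i 1 : Fin 4 → ℚ))]
  · congr 1
    ext x; constructor
    · rintro ⟨a, ha, rfl⟩
      choose f hf using fun i => ha (Set.mem_range_self i)
      refine ⟨f, ?_⟩
      simp only [ExteriorAlgebra.ιMulti_apply, ee]
      congr 2; ext i; rw [← hf i]
    · rintro ⟨f, rfl⟩
      refine ⟨fun i => Pi.single (f i) 1, ?_, ?_⟩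
      · rintro _ ⟨i, rfl⟩; exact ⟨f i, rfl⟩
      · simp only [ExteriorAlgebra.ιMulti_apply, ee]
  · have h := (Pi.basisFun ℚ (Fin 4)).span_eq
    have h2 : (fun i : Fin 4 => (Pi.single i 1 : Fin 4 → ℚ)) = Pi.basisFun ℚ (Fin 4) := by
      funext i; simp
    rw [h2]; exact h

def top4 : ExteriorAlgebra ℚ (Fin 4 → ℚ) := ee 0 * (ee 1 * (ee 2 * ee 3))
def ww : ExteriorAlgebra ℚ (Fin 4 → ℚ) :=
  (2:ℚ) • (ee 0 * ee 1) + (2:ℚ) • (ee 2 * ee 3) + ee 0 * ee 3 - ee 1 * ee 2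

lemma norm4 : ⋀[ℚ]^4 (Fin 4 → ℚ) ≤ Submodule.span ℚ {top4} := by
  rw [span_ee, Submodule.span_le]
  rintro _ ⟨f, rfl⟩
  simp only [List.ofFn_succ, List.ofFn_zero, List.prod_cons, List.prod_nil, mul_one, SetLike.mem_coe]
  generalize f 0 = a
  generalize f (Fin.succ 0) = b
  generalize f (Fin.succ (Fin.succ 0)) = c
  generalize f (Fin.succ (Fin.succ (Fin.succ 0))) = d
  have key : top4 ∈ Submodule.span ℚ {top4} := Submodule.mem_span_singleton_self _
  unfold top4 at *
  fin_cases a <;> fin_cases b <;> fin_cases c <;> fin_cases d <;>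
    simp [ee_sq, ee_sq', ee_swap 1 0, ee_swap 2 0, ee_swap 3 0, ee_swap 2 1, ee_swap 3 1,
      ee_swap 3 2, ee_swap' 1 0, ee_swap' 2 0, ee_swap' 3 0, ee_swap' 2 1, ee_swap' 3 1,
      ee_swap' 3 2, key]

lemma finrank4 : Module.finrank ℚ (⋀[ℚ]^4 (Fin 4 → ℚ)) = 1 := by
  rw [exteriorPower.finrank_eq]; simp

lemma top4_ne : top4 ≠ 0 := by
  intro h
  have h1 := norm4
  rw [h, Submodule.span_zero_singleton, le_bot_iff] at h1
  have := finrank4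
  rw [h1] at this
  simp at this

lemma top4_fixed : top4 ∈ fixedSubmodule Ggroup := by
  rw [fixed_iff]
  have hm : top4 ∈ ⋀[ℚ]^4 (Fin 4 → ℚ) := by
    rw [span_ee]
    exact Submodule.subset_span ⟨id, by simp [top4, List.ofFn_succ]⟩
  refine ⟨?_, by rw [N_apply 4 _ hm]; norm_num, ?_⟩ <;> unfold top4 <;>
  simp only [map_mul, S0, S1, S2, S3, T0, T1, T2, T3] <;>
  simp [mul_add, add_mul, mul_assoc, ee_sq, ee_sq', ee_swap 1 0, ee_swap 2 0, ee_swap 3 0,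
    ee_swap 2 1, ee_swap 3 1,
      ee_swap 3 2, ee_swap' 1 0, ee_swap' 2 0, ee_swap' 3 0, ee_swap' 2 1, ee_swap' 3 1,
      ee_swap' 3 2]

lemma ww_ne : ww ≠ 0 := by
  intro h
  have h2 : ww * (ee 2 * ee 3) = (2:ℚ) • top4 := by
    unfold ww top4
    simp [sub_mul, add_mul, mul_assoc, ee_sq, ee_sq', ee_swap 3 2, ee_swap' 3 2]
  rw [h, zero_mul] at h2
  exact top4_ne (by simpa using h2.symm)

lemma ww_mem : ww ∈ ⋀[ℚ]^2 (Fin 4 → ℚ) := by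
  have h : ∀ i j, ee i * ee j ∈ ⋀[ℚ]^2 (Fin 4 → ℚ) := by
    intro i j
    rw [span_ee]
    exact Submodule.subset_span ⟨![i, j], by simp [List.ofFn_succ]⟩
  exact Submodule.sub_mem _ (Submodule.add_mem _ (Submodule.add_mem _
    (Submodule.smul_mem _ _ (h _ _)) (Submodule.smul_mem _ _ (h _ _))) (h _ _)) (h _ _)

lemma ww_fixed : ww ∈ fixedSubmodule Ggroup := by
  rw [fixed_iff]
  refine ⟨?_, by rw [N_apply 2 _ ww_mem]; norm_num, ?_⟩ <;> unfold ww <;>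
  simp only [map_mul, map_add, map_sub, map_smul, S0, S1, S2, S3, T0, T1, T2, T3] <;>
  simp only [mul_add, add_mul, mul_neg, neg_mul, ee_swap 1 0, ee_swap 2 0, ee_swap 3 0,
    ee_swap 2 1, ee_swap 3 1, ee_swap 3 2] <;> module

/-- six times the averaging operator -/
def PP : ExteriorAlgebra ℚ (Fin 4 → ℚ) →ₗ[ℚ] ExteriorAlgebra ℚ (Fin 4 → ℚ) :=
  let S := SS.toLinearMap
  let T := TT.toLinearMap
  LinearMap.id + S + T + S ∘ₗ T + T ∘ₗ S + S ∘ₗ T ∘ₗ S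

lemma PP_apply (x) : PP x = x + SS x + TT x + SS (TT x) + TT (SS x) + SS (TT (SS x)) := rfl

lemma PP_mem (x) (hx : x ∈ ⋀[ℚ]^2 (Fin 4 → ℚ)) : PP x ∈ Submodule.span ℚ {ww} := by
  suffices h : ⋀[ℚ]^2 (Fin 4 → ℚ) ≤ (Submodule.span ℚ {ww}).comap PP from h hx
  rw [span_ee, Submodule.span_le]
  rintro _ ⟨f, rfl⟩
  simp only [List.ofFn_succ, List.ofFn_zero, List.prod_cons, List.prod_nil, mul_one,
    SetLike.mem_coe, Submodule.mem_comap]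
  generalize f 0 = a
  generalize f (Fin.succ 0) = b
  have main : ∀ a b : Fin 4, a < b → PP (ee a * ee b) ∈ Submodule.span ℚ {ww} := by
    intro a b hab
    rw [Submodule.mem_span_singleton]
    refine ⟨!![0,2,0,-1; 0,0,1,0; 0,0,0,2; 0,0,0,0] a b, ?_⟩
    rw [PP_apply]; unfold ww
    fin_cases a <;> fin_cases b <;> first
    | (exfalso; revert hab; decide)
    | (simp [-map_neg, -map_add, Fin.reduceFinMk, S0, S1, S2, S3, T0, T1, T2, T3]
       simp only [map_mul, map_add, map_neg, S0, S1, S2, S3, T0, T1, T2, T3]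
       simp only [mul_add, add_mul, mul_neg, neg_mul, ee_sq, ee_swap 1 0, ee_swap 2 0, ee_swap 3 0,
         ee_swap 2 1, ee_swap 3 1, ee_swap 3 2]
       module)
  rcases lt_trichotomy a b with h | h | h
  · exact main a b h
  · rw [h, ee_sq, map_zero]; exact Submodule.zero_mem _
  · rw [ee_swap, map_neg]; exact Submodule.neg_mem _ (main b a h)

lemma odd_case (k : ℕ) (hk : Odd k) :
    Module.finrank ℚ ↥(⋀[ℚ]^k (Fin 4 → ℚ) ⊓ fixedSubmodule Ggroup) = 0 := by
  have : ⋀[ℚ]^k (Fin 4 → ℚ) ⊓ fixedSubmodule Ggroup = ⊥ := by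
    rw [eq_bot_iff]
    rintro x ⟨h1, h2⟩
    have h3 := ((fixed_iff x).1 h2).2.1
    rw [N_apply k x h1, hk.neg_one_pow] at h3
    have h4 : (2:ℚ) • x = 0 := by
      have : (2:ℚ) • x = x - (-1:ℚ) • x := by module
      rw [this, h3, sub_self]
    simpa using h4
  rw [this]; simp

theorem stmt_9 :
    Module.finrank ℚ ↥(⋀[ℚ]^0 (Fin 4 → ℚ) ⊓ fixedSubmodule Ggroup) = 1 ∧
    Module.finrank ℚ ↥(⋀[ℚ]^1 (Fin 4 → ℚ) ⊓ fixedSubmodule Ggroup) = 0 ∧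
    Module.finrank ℚ ↥(⋀[ℚ]^2 (Fin 4 → ℚ) ⊓ fixedSubmodule Ggroup) = 1 ∧
    Module.finrank ℚ ↥(⋀[ℚ]^3 (Fin 4 → ℚ) ⊓ fixedSubmodule Ggroup) = 0 ∧
    Module.finrank ℚ ↥(⋀[ℚ]^4 (Fin 4 → ℚ) ⊓ fixedSubmodule Ggroup) = 1 := by
  refine ⟨?_, odd_case 1 (by decide), ?_, odd_case 3 (by decide), ?_⟩
  · rw [inf_eq_left.2, exteriorPower.finrank_eq]
    · simp
    · rw [span_ee, Submodule.span_le]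
      rintro _ ⟨f, rfl⟩
      intro g hg
      simp
  · have : ⋀[ℚ]^2 (Fin 4 → ℚ) ⊓ fixedSubmodule Ggroup = Submodule.span ℚ {ww} := by
      apply le_antisymm
      · rintro x ⟨h1, h2⟩
        obtain ⟨hS, -, hT⟩ := (fixed_iff x).1 h2
        have h := PP_mem x h1
        rw [PP_apply, hS, hT, hS] at h
        have h6 : x = (1/6 : ℚ) • (x + x + x + x + x + x) := by module
        rw [h6]
        exact Submodule.smul_mem _ _ h
      · rw [Submodule.span_singleton_le_iff_mem]
        exact ⟨ww_mem, ww_fixed⟩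
    rw [this, finrank_span_singleton ww_ne]
  · rw [inf_eq_left.2, finrank4]
    exact norm4.trans ((Submodule.span_singleton_le_iff_mem _ _).2 top4_fixed)

end
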